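/- arXiv:0905.2413 — 2 statements merged into one kernel-verified Lean document; each statement's English description precedes it below -/
import Mathlib

section
/- When all fading gains are identical (α_1 = α_2 = ⋯ = α, a single nonnegative random variable α), the optimal coding length is K = 1 with full power: for every integer M ≥ 1 and every power vector (P_1,…,P_M) with P_l ≥ 0 and Σ_{l=1}^{M} P_l ≤ M·P, one has Pr{ (1/M)·Σ_{l=1}^{L_M} log(1+α P_l) < R } ≥ Pr{ (1/1)·Σ_{l=1}^{L_1} log(1+α P) < R }, where L_M = min(M, ⌊T⌋) and L_1 = min(1, ⌊T⌋). (Theorem 2.) -/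
open MeasureTheory ProbabilityTheory Real Finset

/-- **Theorem 2 (identical fading gains): the optimal coding length is `K = 1` with
full power.** When all blocks share the common fading power gain `α`, for every
coding length `M ≥ 1` and every power vector `(P_1,…,P_M)` respecting the average
power budget, the outage probability is at least that of coding over a single block
with power `P`. -/
theorem identical_fading_opt_coding_length_one
    {Ω : Type*} [MeasurableSpace Ω] (μ : Measure Ω) [IsProbabilityMeasure μ]
    (α : Ω → ℝ) (hαmeas : Measurable α) (hαnonneg : ∀ ω, 0 ≤ α ω)
    (T : Ω → ℝ) (hTmeas : Measurable T) (hTpos : ∀ ω, 0 < T ω)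
    (hindep : IndepFun α T μ)
    (R P : ℝ) (hR : 0 < R) (hP : 0 < P)
    (M : ℕ) (hM : 1 ≤ M)
    (Pv : ℕ → ℝ) (hPv : ∀ l, l < M → 0 ≤ Pv l)
    (hbudget : ∑ l ∈ Finset.range M, Pv l ≤ (M : ℝ) * P) :
    μ {ω | (1 / (M : ℝ)) *
          ∑ l ∈ Finset.range (min M (Int.toNat ⌊T ω⌋)), Real.log (1 + α ω * Pv l) < R}
      ≥ μ {ω | (1 / (1 : ℝ)) *
          ∑ _l ∈ Finset.range (min 1 (Int.toNat ⌊T ω⌋)), Real.log (1 + α ω * P) < R} := by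
  refine measure_mono ?_
  intro ω hω
  simp only [Set.mem_setOf_eq] at hω ⊢
  have ha := hαnonneg ω
  generalize α ω = a at *
  generalize Int.toNat ⌊T ω⌋ = n at *
  rcases Nat.eq_zero_or_pos n with hn | hn
  · subst hn
    simpa using hR
  have h1 : min 1 n = 1 := by omega
  rw [h1] at hω
  simp only [Finset.sum_range_one, div_one, one_mul] at hω
  refine lt_of_le_of_lt ?_ hω
  have hMpos : (0 : ℝ) < M := by exact_mod_cast hM
  have hy : 0 < 1 + a * P := by positivity
  have hsub : ∑ l ∈ Finset.range (min M n), Real.log (1 + a * Pv l)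
      ≤ ∑ l ∈ Finset.range M, Real.log (1 + a * Pv l) := by
    apply Finset.sum_le_sum_of_subset_of_nonneg
    · exact Finset.range_mono (min_le_left _ _)
    · intro l hl _
      have := mul_nonneg ha (hPv l (Finset.mem_range.mp hl))
      exact Real.log_nonneg (by linarith)
  have hterm : ∀ l ∈ Finset.range M, Real.log (1 + a * Pv l)
      ≤ Real.log (1 + a * P) + (a / (1 + a * P)) * (Pv l - P) := by
    intro l hl
    have h0 := mul_nonneg ha (hPv l (Finset.mem_range.mp hl))
    have hx : 0 < 1 + a * Pv l := by linarith
    have h := Real.log_le_sub_one_of_pos (div_pos hx hy)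
    rw [Real.log_div hx.ne' hy.ne'] at h
    have e : (1 + a * Pv l) / (1 + a * P) - 1 = (a / (1 + a * P)) * (Pv l - P) := by
      field_simp
      ring
    linarith
  have hsum := Finset.sum_le_sum hterm
  rw [Finset.sum_add_distrib, ← Finset.mul_sum, Finset.sum_sub_distrib] at hsum
  simp only [Finset.sum_const, Finset.card_range, nsmul_eq_mul] at hsum
  have hc : (a / (1 + a * P)) * (∑ l ∈ Finset.range M, Pv l - M * P) ≤ 0 :=
    mul_nonpos_of_nonneg_of_nonpos (by positivity) (by linarith)
  rw [one_div, inv_mul_le_iff₀ hMpos]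
  linarith
end

section
/- Let K ≥ 1 be an integer, R > 0, and w_1,…,w_K ≥ 0. The function p(P_1,…,P_K) = w_0 + Σ_{n=1}^{K} (w_n/2)·( 1 + erf( (KR − Σ_{i=1}^{n} log P_i) / √(2n) ) ) is convex on the convex set of vectors (P_1,…,P_K) with P_i > 0 satisfying KR − Σ_{i=1}^{n} log P_i ≤ 0 for every n = 1,…,K. (Lemma 2: convexity of the log-normal upper-bound objective.) -/
open Real Finset

/-- The Gauss error function `erf(x) = (2/√π)·∫_0^x e^{−t²} dt`. -/
noncomputable def erf (x : ℝ) : ℝ :=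
  (2 / Real.sqrt Real.pi) * ∫ t in (0 : ℝ)..x, Real.exp (-t ^ 2)

lemma erf_hasDerivAt (x : ℝ) :
    HasDerivAt erf ((2 / Real.sqrt Real.pi) * Real.exp (-x ^ 2)) x := by
  have hc : Continuous (fun t : ℝ => Real.exp (-t ^ 2)) := by fun_prop
  exact (hc.integral_hasStrictDerivAt 0 x).hasDerivAt.const_mul _

lemma erf_monotone : Monotone erf := by
  apply monotone_of_deriv_nonneg (fun x => (erf_hasDerivAt x).differentiableAt)
  intro x
  rw [(erf_hasDerivAt x).deriv]
  positivity

lemma erf_convexOn : ConvexOn ℝ (Set.Iic 0) erf := by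
  have hd : Differentiable ℝ erf := fun x => (erf_hasDerivAt x).differentiableAt
  apply MonotoneOn.convexOn_of_deriv (convex_Iic 0) hd.continuous.continuousOn
    hd.differentiableOn
  intro x hx y hy hxy
  rw [interior_Iic, Set.mem_Iio] at hx hy
  rw [(erf_hasDerivAt x).deriv, (erf_hasDerivAt y).deriv]
  have : -x ^ 2 ≤ -y ^ 2 := by nlinarith
  gcongr

lemma arg_le {ι : Type*} (s : Finset ι) (c : ℝ) (P Q : ι → ℝ) (hP : ∀ i, 0 < P i)
    (hQ : ∀ i, 0 < Q i) (a b : ℝ) (ha : 0 ≤ a) (hb : 0 ≤ b) (hab : a + b = 1) :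
    c - ∑ i ∈ s, Real.log ((a • P + b • Q) i) ≤
      a * (c - ∑ i ∈ s, Real.log (P i)) + b * (c - ∑ i ∈ s, Real.log (Q i)) := by
  have h : ∑ i ∈ s, (a * Real.log (P i) + b * Real.log (Q i)) ≤
      ∑ i ∈ s, Real.log ((a • P + b • Q) i) := by
    apply Finset.sum_le_sum
    intro i _
    exact strictConcaveOn_log_Ioi.concaveOn.2 (hP i) (hQ i) ha hb hab
  rw [Finset.sum_add_distrib, ← Finset.mul_sum, ← Finset.mul_sum] at h
  have : c = a * c + b * c := by rw [← add_mul, hab, one_mul]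
  linarith

/-- **Lemma 2: convexity of the log-normal upper-bound objective.** For `K ≥ 1`,
`R > 0` and nonnegative weights `w_1,…,w_K`, the function
`p(P) = w_0 + Σ_{n=1}^{K} (w_n/2)(1 + erf((KR − Σ_{i=1}^{n} log P_i)/√(2n)))`
is convex on the convex set of positive power vectors satisfying
`KR − Σ_{i=1}^{n} log P_i ≤ 0` for every `n = 1,…,K`. -/
theorem lognormal_upper_bound_objective_convex
    (K : ℕ) (hK : 1 ≤ K) (R : ℝ) (hR : 0 < R)
    (w0 : ℝ) (w : ℕ → ℝ) (hw : ∀ n ∈ Finset.Icc 1 K, 0 ≤ w n) :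
    ConvexOn ℝ
      {P : Fin K → ℝ | (∀ i, 0 < P i) ∧
        ∀ n ∈ Finset.Icc 1 K,
          (K : ℝ) * R
              - ∑ i ∈ Finset.univ.filter (fun i : Fin K => (i : ℕ) < n), Real.log (P i)
            ≤ 0}
      (fun P => w0 + ∑ n ∈ Finset.Icc 1 K,
        (w n / 2) *
          (1 + erf (((K : ℝ) * R
              - ∑ i ∈ Finset.univ.filter (fun i : Fin K => (i : ℕ) < n), Real.log (P i))
            / Real.sqrt (2 * (n : ℝ))))) := by
  constructor
  · rintro P ⟨hP, hP'⟩ Q ⟨hQ, hQ'⟩ a b ha hb hab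
    refine ⟨fun i => (convex_Ioi (0 : ℝ)) (hP i) (hQ i) ha hb hab, fun n hn => ?_⟩
    refine (arg_le _ _ P Q hP hQ a b ha hb hab).trans ?_
    have h1 := mul_nonneg ha (neg_nonneg.2 (hP' n hn))
    have h2 := mul_nonneg hb (neg_nonneg.2 (hQ' n hn))
    linarith
  · rintro P ⟨hP, hP'⟩ Q ⟨hQ, hQ'⟩ a b ha hb hab
    simp only [smul_eq_mul]
    have hw0 : w0 = a * w0 + b * w0 := by rw [← add_mul, hab, one_mul]
    rw [mul_add, mul_add, Finset.mul_sum, Finset.mul_sum]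
    have key : ∀ A B C : ℝ, A ≤ B + C → w0 + A ≤ a * w0 + B + (a * w0 * 0 + b * w0 + C) := by
      intro A B C h
      linarith
    refine (key _ _ _ ?_).trans (le_of_eq (by rw [mul_zero, zero_add]))
    rw [← Finset.sum_add_distrib]
    apply Finset.sum_le_sum
    intro n hn
    have hs := Real.sqrt_nonneg (2 * (n : ℝ))
    have h1 := div_le_div_of_nonneg_right (arg_le (Finset.univ.filter
      (fun i : Fin K => (i : ℕ) < n)) ((K : ℝ) * R) P Q hP hQ a b ha hb hab) hs
    rw [add_div, mul_div_assoc, mul_div_assoc] at h1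
    have h2 := (erf_monotone h1).trans (erf_convexOn.2
      (Set.mem_Iic.2 (div_nonpos_of_nonpos_of_nonneg (hP' n hn) hs))
      (Set.mem_Iic.2 (div_nonpos_of_nonpos_of_nonneg (hQ' n hn) hs)) ha hb hab)
    simp only [smul_eq_mul] at h2
    have h3 := mul_le_mul_of_nonneg_left h2 (div_nonneg (hw n hn) zero_le_two)
    have hw1 : w n / 2 = a * (w n / 2) + b * (w n / 2) := by rw [← add_mul, hab, one_mul]
    linarith
end
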